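/- arXiv:2306.13555 — 4 statements merged into one kernel-verified Lean document; each statement's English description precedes it below -/
import Mathlib

section
/- Let g ≥ 4 and let d ≥ 3 be odd. There is no ℤ-module automorphism f of M = ℤ^g/⟨2σ⟩ preserving the mod-2 intersection form ⋆ such that the induced automorphism Φ̂(f) of M/⟨σ̄⟩ ≅ ℤ^{g−1} equals the elementary matrix power e_{12}^d, i.e., such that the induced map sends the class of α_2 to d·[α_1] + [α_2] and fixes the classes of α_j for all j ≠ 2, 1 ≤ j ≤ g−1. -/
noncomputable section

open Submodule

/-- σ = e₁ + ⋯ + e_g ∈ ℤ^g, the sum of the standard basis vectors. -/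
def sigmaVec (g : ℕ) : Fin g → ℤ := ∑ i, Pi.single i 1

/-- The submodule ⟨2σ⟩ of ℤ^g. -/
def relSub (g : ℕ) : Submodule ℤ (Fin g → ℤ) :=
  Submodule.span ℤ {(2 : ℤ) • sigmaVec g}

/-- M = ℤ^g/⟨2σ⟩. -/
abbrev Mg (g : ℕ) := (Fin g → ℤ) ⧸ relSub g

/-- α_i ∈ M, the image of the standard basis vector e_i. -/
def alphaCl (g : ℕ) (i : Fin g) : Mg g := Submodule.Quotient.mk (Pi.single i 1)

/-- σ̄ = α₁ + ⋯ + α_g ∈ M. -/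
def sigmaBar (g : ℕ) : Mg g := ∑ i, alphaCl g i

/-- Coordinatewise reduction ℤ^g → (ℤ/2ℤ)^g, as a ℤ-linear map. -/
def redHom (g : ℕ) : (Fin g → ℤ) →ₗ[ℤ] (Fin g → ZMod 2) :=
  LinearMap.pi fun i => (Int.castAddHom (ZMod 2)).toIntLinearMap.comp (LinearMap.proj i)

lemma relSub_le_ker (g : ℕ) : relSub g ≤ LinearMap.ker (redHom g) := by
  rw [relSub, Submodule.span_le, Set.singleton_subset_iff]
  simp only [SetLike.mem_coe, LinearMap.mem_ker, map_smul]
  ext i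
  simp [redHom]
  left
  decide

/-- The mod-2 reduction M → (ℤ/2ℤ)^g (well defined since 2σ reduces to 0). -/
def redQ (g : ℕ) : Mg g →ₗ[ℤ] (Fin g → ZMod 2) :=
  Submodule.liftQ (relSub g) (redHom g) (relSub_le_ker g)

/-- The mod-2 intersection form ⋆ : M × M → ℤ/2ℤ, induced by the standard
inner product of ℤ^g reduced modulo 2. -/
def starForm (g : ℕ) (x y : Mg g) : ZMod 2 := ∑ i, redQ g x i * redQ g y i

/-- The projection M → M/⟨σ̄⟩. -/
def mkQs (g : ℕ) : Mg g →ₗ[ℤ] (Mg g ⧸ Submodule.span ℤ {sigmaBar g}) :=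
  (Submodule.span ℤ {sigmaBar g}).mkQ

lemma redQ_alphaCl (g : ℕ) (i : Fin g) : redQ g (alphaCl g i) = Pi.single i 1 := by
  ext j
  by_cases h : j = i
  · subst h
    simp [redQ, alphaCl, redHom]
  · simp [redQ, alphaCl, redHom, h]

lemma redQ_sigmaBar (g : ℕ) : redQ g (sigmaBar g) = 1 := by
  rw [sigmaBar, map_sum]
  simp only [redQ_alphaCl]
  exact Finset.univ_sum_single (1 : Fin g → ZMod 2)

lemma starForm_eq_dotProduct (g : ℕ) (x y : Mg g) :
    starForm g x y = redQ g x ⬝ᵥ redQ g y := rfl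

/-- Equality modulo `σ̄` determines the mod-2 reduction up to a multiple of the all-ones vector. -/
lemma exists_redQ_eq_of_mkQs_eq (g : ℕ) {x y : Mg g} (h : mkQs g x = mkQs g y) :
    ∃ c : ZMod 2, redQ g x = redQ g y + c • 1 := by
  rw [← sub_eq_zero, ← map_sub, mkQs, Submodule.mkQ_apply, Submodule.Quotient.mk_eq_zero,
    Submodule.mem_span_singleton] at h
  obtain ⟨c, hc⟩ := h
  refine ⟨c, ?_⟩
  rw [← sub_eq_iff_eq_add', ← map_sub, ← hc, map_smul, redQ_sigmaBar, Int.cast_smul_eq_zsmul]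

/-- For g ≥ 4 and odd d ≥ 3, there is no ℤ-module automorphism f of M = ℤ^g/⟨2σ⟩
preserving the mod-2 intersection form ⋆ whose induced automorphism of M/⟨σ̄⟩
equals e₁₂^d, i.e. which sends the class of α₂ to d·[α₁] + [α₂] and fixes the
classes of α_j for all 1 ≤ j ≤ g−1 with j ≠ 2. -/
theorem stmt2 (g d : ℕ) (hg : 4 ≤ g) (hd : 3 ≤ d) (hodd : Odd d)
    (f : Mg g ≃ₗ[ℤ] Mg g)
    (hstar : ∀ x y : Mg g, starForm g (f x) (f y) = starForm g x y) :
    ¬ ((mkQs g (f (alphaCl g ⟨1, by omega⟩)) =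
          (d : ℤ) • mkQs g (alphaCl g ⟨0, by omega⟩) + mkQs g (alphaCl g ⟨1, by omega⟩)) ∧
       (∀ j : Fin g, (j : ℕ) < g - 1 → (j : ℕ) ≠ 1 →
          mkQs g (f (alphaCl g j)) = mkQs g (alphaCl g j))) := by
  rintro ⟨h₂, hfix⟩
  have h₁ := hfix ⟨0, by omega⟩ (by simp; omega) (by simp)
  have h₃ := hfix ⟨2, by omega⟩ (by simp; omega) (by simp)
  rw [← map_smul, ← map_add] at h₂
  obtain ⟨a, ha⟩ := exists_redQ_eq_of_mkQs_eq g h₁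
  obtain ⟨b, hb⟩ := exists_redQ_eq_of_mkQs_eq g h₂
  obtain ⟨c, hc⟩ := exists_redQ_eq_of_mkQs_eq g h₃
  have hd₂ : (d : ZMod 2) = 1 := (ZMod.natCast_eq_one_iff_odd).2 hodd
  have e₁₁ := hstar (alphaCl g ⟨0, by omega⟩) (alphaCl g ⟨0, by omega⟩)
  have e₁₂ := hstar (alphaCl g ⟨0, by omega⟩) (alphaCl g ⟨1, by omega⟩)
  have e₃₃ := hstar (alphaCl g ⟨2, by omega⟩) (alphaCl g ⟨2, by omega⟩)
  have e₃₂ := hstar (alphaCl g ⟨2, by omega⟩) (alphaCl g ⟨1, by omega⟩)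
  simp only [starForm_eq_dotProduct, ha, hb, hc, map_add, map_smul, redQ_alphaCl,
    ← Int.cast_smul_eq_zsmul (ZMod 2), Int.cast_natCast, hd₂, add_dotProduct, dotProduct_add,
    smul_dotProduct, dotProduct_smul] at e₁₁ e₁₂ e₃₃ e₃₂
  simp at e₁₁ e₁₂ e₃₃ e₃₂
  generalize (g : ZMod 2) = n at e₁₁ e₁₂ e₃₃ e₃₂
  clear ha hb hc
  revert a b c n
  decide
end
end

section
/- Let g ≥ 2 be even. Every ℤ-module automorphism f of M = ℤ^g/⟨2σ⟩ that preserves the mod-2 intersection form ⋆ and induces the identity automorphism of M/⟨σ̄⟩ is either the identity automorphism of M, or the involution T of M determined by T(α_i) = α_i + σ̄ for all 1 ≤ i ≤ g (T is a well-defined automorphism of M when g is even). -/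
noncomputable section

open Submodule

lemma mk_sigmaVec (g : ℕ) : (relSub g).mkQ (sigmaVec g) = sigmaBar g := by
  simp only [sigmaVec, sigmaBar, alphaCl, map_sum, Submodule.mkQ_apply]

lemma two_smul_sigmaBar (g : ℕ) : (2 : ℤ) • sigmaBar g = 0 := by
  rw [← mk_sigmaVec, ← map_smul, Submodule.mkQ_apply, Submodule.Quotient.mk_eq_zero]
  exact Submodule.mem_span_singleton_self _

lemma even_smul_sigmaBar (g : ℕ) {n : ℤ} (hn : Even n) : n • sigmaBar g = 0 := by
  obtain ⟨k, rfl⟩ := hn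
  rw [← mul_two, mul_smul, two_smul_sigmaBar, smul_zero]

lemma eq_zero_or_eq_sigmaBar (g : ℕ) {x : Mg g}
    (hx : x ∈ Submodule.span ℤ {sigmaBar g}) : x = 0 ∨ x = sigmaBar g := by
  obtain ⟨n, rfl⟩ := Submodule.mem_span_singleton.mp hx
  rcases Int.even_or_odd n with hn | ⟨k, rfl⟩
  · exact Or.inl (even_smul_sigmaBar g hn)
  · right
    rw [add_smul, even_smul_sigmaBar g (even_two_mul k), zero_add, one_smul]

lemma starForm_add_left (g : ℕ) (x y z : Mg g) :
    starForm g (x + y) z = starForm g x z + starForm g y z := by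
  simp [starForm, add_mul, Finset.sum_add_distrib]

lemma starForm_sigmaBar_alphaCl (g : ℕ) (i : Fin g) :
    starForm g (sigmaBar g) (alphaCl g i) = 1 := by
  simp [starForm, redQ_alphaCl, redQ_sigmaBar]

lemma linearMap_ext_alphaCl (g : ℕ) {N : Type*} [AddCommGroup N] {f h : Mg g →ₗ[ℤ] N}
    (H : ∀ i, f (alphaCl g i) = h (alphaCl g i)) : f = h := by
  apply Submodule.linearMap_qext
  refine LinearMap.pi_ext' fun i => LinearMap.ext_ring ?_
  exact H i

/-- The coordinate sum `ℤ^g → ℤ`. -/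
def coordSum (g : ℕ) : (Fin g → ℤ) →ₗ[ℤ] ℤ := ∑ i, LinearMap.proj i

/-- The map `x ↦ x̄ + (∑ i, x i) σ̄` from `ℤ^g` to `M`. -/
def sigmaShiftLift (g : ℕ) : (Fin g → ℤ) →ₗ[ℤ] Mg g :=
  (relSub g).mkQ + (LinearMap.toSpanSingleton ℤ (Mg g) (sigmaBar g)).comp (coordSum g)

lemma relSub_le_ker_sigmaShiftLift (g : ℕ) :
    relSub g ≤ LinearMap.ker (sigmaShiftLift g) := by
  refine (Submodule.span_singleton_le_iff_mem _ _).mpr (LinearMap.mem_ker.mpr ?_)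
  rw [map_smul, sigmaShiftLift, LinearMap.add_apply, mk_sigmaVec, smul_add, two_smul_sigmaBar,
    zero_add, LinearMap.comp_apply, LinearMap.toSpanSingleton_apply, smul_smul]
  exact even_smul_sigmaBar g (even_two_mul _)

/-- The endomorphism of `M` sending each `α_i` to `α_i + σ̄`. -/
def sigmaShift (g : ℕ) : Mg g →ₗ[ℤ] Mg g :=
  (relSub g).liftQ (sigmaShiftLift g) (relSub_le_ker_sigmaShiftLift g)

lemma sigmaShift_alphaCl (g : ℕ) (i : Fin g) :
    sigmaShift g (alphaCl g i) = alphaCl g i + sigmaBar g := by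
  rw [alphaCl, sigmaShift, Submodule.liftQ_apply]
  simp [sigmaShiftLift, coordSum]

lemma sigmaShift_sigmaBar (g : ℕ) (heven : Even g) :
    sigmaShift g (sigmaBar g) = sigmaBar g := by
  have h := even_smul_sigmaBar g ((Int.even_coe_nat g).mpr heven)
  rw [natCast_zsmul] at h
  conv_lhs => rw [sigmaBar, map_sum]
  simp only [sigmaShift_alphaCl, Finset.sum_add_distrib, Finset.sum_const, Finset.card_univ,
    Fintype.card_fin, h, add_zero]
  rfl

lemma sigmaShift_involutive (g : ℕ) (heven : Even g) :
    Function.Involutive (sigmaShift g) := by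
  have h : (sigmaShift g).comp (sigmaShift g) = LinearMap.id := by
    refine linearMap_ext_alphaCl g fun i => ?_
    rw [LinearMap.comp_apply, sigmaShift_alphaCl, map_add, sigmaShift_alphaCl,
      sigmaShift_sigmaBar g heven, add_assoc, ← two_zsmul, two_smul_sigmaBar, add_zero,
      LinearMap.id_apply]
  exact fun x => LinearMap.congr_fun h x

/-- For even g ≥ 2: the map T with T(α_i) = α_i + σ̄ for all i is a well-defined
involutive ℤ-module automorphism of M = ℤ^g/⟨2σ⟩, and every ℤ-module
automorphism of M that preserves the mod-2 intersection form ⋆ and induces the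
identity on M/⟨σ̄⟩ is either the identity automorphism of M or T. -/
theorem stmt6 (g : ℕ) (hg : 2 ≤ g) (heven : Even g) :
    (∃ T : Mg g ≃ₗ[ℤ] Mg g,
      (∀ i : Fin g, T (alphaCl g i) = alphaCl g i + sigmaBar g) ∧
      ∀ x : Mg g, T (T x) = x) ∧
    ∀ f : Mg g ≃ₗ[ℤ] Mg g,
      (∀ x y : Mg g, starForm g (f x) (f y) = starForm g x y) →
      (∀ x : Mg g, mkQs g (f x) = mkQs g x) →
      (∀ x : Mg g, f x = x) ∨
        (∀ i : Fin g, f (alphaCl g i) = alphaCl g i + sigmaBar g) := by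
  refine ⟨⟨LinearEquiv.ofInvolutive (sigmaShift g) (sigmaShift_involutive g heven),
    sigmaShift_alphaCl g, sigmaShift_involutive g heven⟩, fun f hstar hid => ?_⟩
  have hf (i : Fin g) : f (alphaCl g i) = alphaCl g i ∨
      f (alphaCl g i) = alphaCl g i + sigmaBar g := by
    have hmem := (Submodule.Quotient.eq _).mp (hid (alphaCl g i))
    exact (eq_zero_or_eq_sigmaBar g hmem).imp sub_eq_zero.mp sub_eq_iff_eq_add'.mp
  by_cases hfix : ∀ i, f (alphaCl g i) = alphaCl g i
  · left
    have h : (f : Mg g →ₗ[ℤ] Mg g) = LinearMap.id := linearMap_ext_alphaCl g hfix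
    exact fun x => LinearMap.congr_fun h x
  · right
    push Not at hfix
    obtain ⟨i, hi⟩ := hfix
    refine fun j => (hf j).resolve_left fun hj => ?_
    have h := hstar (alphaCl g i) (alphaCl g j)
    rw [(hf i).resolve_left hi, hj, starForm_add_left, starForm_sigmaBar_alphaCl] at h
    exact one_ne_zero (add_eq_left.mp h)
end
end

section
/- Let d ≥ 2, g ≥ 2 and n ≥ 1 be integers. Let H be a group and x_1, …, x_g, y_1, …, y_{n−1} ∈ H. Let G be the subgroup of H generated by the set X = {x_i x_g : 1 ≤ i ≤ g−1} ∪ {x_j^2 : 1 ≤ j ≤ g} ∪ {y_k : 1 ≤ k ≤ n−1} ∪ {x_g y_k x_g^{−1} : 1 ≤ k ≤ n−1}. Suppose θ : G → (ℤ/dℤ)^{g−1} is a group homomorphism with θ(x_i x_g) = e_i (the i-th standard basis vector) for 1 ≤ i ≤ g−1 and θ(x_j^2) = θ(y_k) = θ(x_g y_k x_g^{−1}) = 0 for all j, k. Let W = {(x_1 x_g)^{m_1}(x_2 x_g)^{m_2}⋯(x_{g−1} x_g)^{m_{g−1}} : 0 ≤ m_i ≤ d−1}. Then the kernel of θ is generated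 by the elements w t w^{−1}, where w ranges over W and t ranges over the set {(x_i x_g)^d : 1 ≤ i ≤ g−1} ∪ {x_j^2 : 1 ≤ j ≤ g} ∪ {y_k : 1 ≤ k ≤ n−1} ∪ {x_g y_k x_g^{−1} : 1 ≤ k ≤ n−1} ∪ {(x_{i_1} x_{i_2} x_g)^2 : 1 ≤ i_1 < i_2 ≤ g−1}. -/
section PowerWords

variable {H : Type*} [Group H]

/-- The word `b 0 ^ m 0 * b 1 ^ m 1 * ⋯ * b (l - 1) ^ m (l - 1)`. -/
def powerWord (b : ℕ → H) (l : ℕ) (m : ℕ → ℕ) : H :=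
  ((List.range l).map fun i => b i ^ m i).prod

theorem powerWord_succ (b : ℕ → H) (l : ℕ) (m : ℕ → ℕ) :
    powerWord b (l + 1) m = powerWord b l m * b l ^ m l := by
  simp [powerWord, List.range_succ]

theorem powerWord_congr (b : ℕ → H) {l : ℕ} {m m' : ℕ → ℕ} (h : ∀ i < l, m i = m' i) :
    powerWord b l m = powerWord b l m' := by
  unfold powerWord
  congr 1
  apply List.map_congr_left
  intro i hi
  rw [h i (List.mem_range.1 hi)]

theorem powerWord_eq_of_forall_eq_zero (b : ℕ → H) {l k : ℕ} {m : ℕ → ℕ} (hlk : l ≤ k)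
    (h : ∀ i, l ≤ i → i < k → m i = 0) : powerWord b k m = powerWord b l m := by
  induction k, hlk using Nat.le_induction with
  | base => rfl
  | succ k hk ih =>
    rw [powerWord_succ, h k hk (by omega), pow_zero, mul_one]
    exact ih fun i h1 h2 => h i h1 (by omega)

/-- Two elements of a group lie in the same right coset of `K`. -/
def SameRightCoset (K : Subgroup H) (u v : H) : Prop := u * v⁻¹ ∈ K

namespace SameRightCoset

variable {K : Subgroup H} {u v w : H}

theorem refl (u : H) : SameRightCoset K u u := by simp [SameRightCoset]

theorem symm (h : SameRightCoset K u v) : SameRightCoset K v u := by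
  simpa [SameRightCoset] using K.inv_mem h

theorem trans (h : SameRightCoset K u v) (h' : SameRightCoset K v w) :
    SameRightCoset K u w := by
  simpa [SameRightCoset, mul_assoc] using K.mul_mem h h'

theorem mul_right (h : SameRightCoset K u v) (s : H) :
    SameRightCoset K (u * s) (v * s) := by
  simpa [SameRightCoset, mul_assoc] using h

theorem mul_inv_right (h : SameRightCoset K (u * v) u) : SameRightCoset K (u * v⁻¹) u := by
  simpa using (h.mul_right v⁻¹).symm

/-- If `b * c⁻¹ * s * b⁻¹ * q * c` fixes the coset of `u * c`, while `q` fixes that of `u`,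
`s` fixes that of `v` and `b` takes the coset of `u` to that of `v`, then `b` takes the coset
of `u * c` to that of `v * c`. -/
theorem square {b c s q : H}
    (ht : SameRightCoset K (u * c * (b * c⁻¹ * s * b⁻¹ * q * c)) (u * c))
    (hq : SameRightCoset K (u * q) u) (hs : SameRightCoset K (v * s) v)
    (hb : SameRightCoset K (u * b) v) : SameRightCoset K (u * c * b) (v * c) := by
  have h1 := ht.mul_right (c⁻¹ * q⁻¹ * b * s⁻¹ * c)
  have h2 := (hq.mul_inv_right).mul_right (b * s⁻¹ * c)
  have h3 := hb.mul_right (s⁻¹ * c)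
  have h4 := (hs.mul_inv_right).mul_right c
  simp only [mul_assoc, mul_inv_cancel_left, inv_mul_cancel_left, inv_mul_cancel, mul_one] at h1 h2 h3 h4 ⊢
  exact ((h1.trans h2).trans h3).trans h4

end SameRightCoset

/-- Right multiplication by a letter permutes the right cosets represented by the words
`powerWord b l m` with exponents less than `d`. -/
theorem sameRightCoset_powerWord_mul {K : Subgroup H} {b q s : ℕ → H} {d N : ℕ} (hd : 0 < d)
    (hpow : ∀ m : ℕ → ℕ, (∀ i, m i < d) → ∀ i < N,
      SameRightCoset K (powerWord b N m * b i ^ d) (powerWord b N m))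
    (hq : ∀ m : ℕ → ℕ, (∀ i, m i < d) → ∀ i < N,
      SameRightCoset K (powerWord b N m * q i) (powerWord b N m))
    (hs : ∀ m : ℕ → ℕ, (∀ i, m i < d) → ∀ i < N,
      SameRightCoset K (powerWord b N m * s i) (powerWord b N m))
    (hsq : ∀ m : ℕ → ℕ, (∀ i, m i < d) → ∀ i j, i < j → j < N →
      SameRightCoset K (powerWord b N m * (b i * (b j)⁻¹ * s j * (b i)⁻¹ * q i * b j))
        (powerWord b N m))
    {l : ℕ} (hl : l ≤ N) {m : ℕ → ℕ} (hm : ∀ i, m i < d) {i : ℕ} (hi : i < l) :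
    SameRightCoset K (powerWord b l m * b i)
      (powerWord b l (Function.update m i ((m i + 1) % d))) := by
  induction l generalizing m i with
  | zero => omega
  | succ l ih =>
    have hprefix : ∀ m : ℕ → ℕ, (∀ i, m i < d) → ∀ e < d, ∃ m' : ℕ → ℕ, (∀ i, m' i < d) ∧
        powerWord b N m' = powerWord b l m * b l ^ e := by
      intro m hm e he
      refine ⟨fun k => if k < l then m k else if k = l then e else 0, fun k => ?_, ?_⟩
      · have := hm k
        dsimp only
        split_ifs <;> assumption
      · rw [powerWord_eq_of_forall_eq_zero b hl, powerWord_succ]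
        · rw [powerWord_congr b (m' := m) fun k hk => by simp [hk]]
          simp
        · intro k hk _
          rw [if_neg (by omega), if_neg (by omega)]
    rcases Nat.lt_succ_iff_lt_or_eq.1 hi with hil | rfl
    · have key : ∀ e < d, SameRightCoset K (powerWord b l m * b l ^ e * b i)
          (powerWord b l (Function.update m i ((m i + 1) % d)) * b l ^ e) := by
        intro e
        induction e with
        | zero => intro _; simpa using ih (by omega) hm hil
        | succ e ihe =>
          intro he
          have hm' : ∀ k, Function.update m i ((m i + 1) % d) k < d := by
            intro k
            by_cases hk : k = i
            · subst hk
              simpa using Nat.mod_lt _ hd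
            · simpa [hk] using hm k
          obtain ⟨mu, hmu, eu⟩ := hprefix m hm e (by omega)
          obtain ⟨mc, hmc, ec⟩ := hprefix m hm (e + 1) he
          obtain ⟨mv, hmv, ev⟩ := hprefix _ hm' e (by omega)
          have h1 := hsq mc hmc i l hil (by omega)
          have h2 := hq mu hmu i (by omega)
          have h3 := hs mv hmv l (by omega)
          rw [ec, pow_succ, ← mul_assoc (powerWord b l m)] at h1
          rw [eu] at h2
          rw [ev] at h3
          rw [pow_succ, ← mul_assoc, ← mul_assoc]
          exact h1.square h2 h3 (ihe (by omega))
      rw [powerWord_succ, powerWord_succ, Function.update_of_ne (by omega)]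
      exact key _ (hm l)
    · rw [powerWord_succ, powerWord_succ, Function.update_self, mul_assoc, ← pow_succ,
        powerWord_congr b (m := Function.update m i _) (m' := m)
          fun k hk => Function.update_of_ne (by omega) _ _]
      rcases Nat.lt_or_ge (m i + 1) d with h | h
      · rw [Nat.mod_eq_of_lt h]
        exact .refl _
      · have hmi := hm i
        obtain ⟨m', hm', e'⟩ := hprefix m hm 0 hd
        have h1 := hpow m' hm' i (by omega)
        rw [show m i + 1 = d by omega, Nat.mod_self]
        rw [e'] at h1
        simpa using h1

end PowerWords

/-- Abstract form of Proposition (gen-ker-theta): with G ≤ H the subgroup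
generated by X = {x_i x_g, x_j², y_k, x_g y_k x_g⁻¹} and θ : G → (ℤ/dℤ)^{g−1}
a homomorphism with θ(x_i x_g) = e_i and θ = 0 on the other generators, the
kernel of θ is generated by the conjugates w t w⁻¹ with w ranging over the words
(x₁x_g)^{m₁}⋯(x_{g−1}x_g)^{m_{g−1}} (0 ≤ m_i ≤ d−1) and t over
{(x_i x_g)^d, x_j², y_k, x_g y_k x_g⁻¹, (x_{i₁} x_{i₂} x_g)²}. -/
theorem stmt8 {H : Type*} [Group H] (d g n : ℕ) (hd : 2 ≤ d) (hg : 2 ≤ g) (hn : 1 ≤ n)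
    (x y : ℕ → H)
    (X : Set H)
    (hX : X = {h | ∃ i, 1 ≤ i ∧ i ≤ g - 1 ∧ h = x i * x g} ∪
              {h | ∃ j, 1 ≤ j ∧ j ≤ g ∧ h = x j ^ 2} ∪
              {h | ∃ k, 1 ≤ k ∧ k ≤ n - 1 ∧ h = y k} ∪
              {h | ∃ k, 1 ≤ k ∧ k ≤ n - 1 ∧ h = x g * y k * (x g)⁻¹})
    (θ : H → (Fin (g - 1) → ZMod d))
    (hhom : ∀ a b : H, a ∈ Subgroup.closure X → b ∈ Subgroup.closure X →
      θ (a * b) = θ a + θ b)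
    (hθx : ∀ i, ∀ h1 : 1 ≤ i, ∀ h2 : i ≤ g - 1,
      θ (x i * x g) = Pi.single (⟨i - 1, by omega⟩ : Fin (g - 1)) 1)
    (hθsq : ∀ j, 1 ≤ j → j ≤ g → θ (x j ^ 2) = 0)
    (hθy : ∀ k, 1 ≤ k → k ≤ n - 1 → θ (y k) = 0)
    (hθz : ∀ k, 1 ≤ k → k ≤ n - 1 → θ (x g * y k * (x g)⁻¹) = 0)
    (W : Set H)
    (hW : W = {h | ∃ m : ℕ → ℕ, (∀ i, m i ≤ d - 1) ∧
      h = (((List.range (g - 1)).map fun i => (x (i + 1) * x g) ^ m (i + 1)).prod)})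
    (T : Set H)
    (hT : T = {h | ∃ i, 1 ≤ i ∧ i ≤ g - 1 ∧ h = (x i * x g) ^ d} ∪
              {h | ∃ j, 1 ≤ j ∧ j ≤ g ∧ h = x j ^ 2} ∪
              {h | ∃ k, 1 ≤ k ∧ k ≤ n - 1 ∧ h = y k} ∪
              {h | ∃ k, 1 ≤ k ∧ k ≤ n - 1 ∧ h = x g * y k * (x g)⁻¹} ∪
              {h | ∃ i1 i2, 1 ≤ i1 ∧ i1 < i2 ∧ i2 ≤ g - 1 ∧ h = (x i1 * x i2 * x g) ^ 2}) :
    ∀ h : H, h ∈ Subgroup.closure {u | ∃ w ∈ W, ∃ t ∈ T, u = w * t * w⁻¹} ↔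
      (h ∈ Subgroup.closure X ∧ θ h = 0) := by
  classical
  obtain ⟨N, rfl⟩ : ∃ N, g = N + 1 := ⟨g - 1, by omega⟩
  simp only [Nat.add_sub_cancel] at *
  set c := x (N + 1) with hc
  set b : ℕ → H := fun i => x (i + 1) * c with hb
  have hWmem : ∀ h, h ∈ W ↔ ∃ m : ℕ → ℕ, (∀ i, m i < d) ∧ h = powerWord b N m := by
    intro h
    rw [hW]
    constructor
    · rintro ⟨m, hm, rfl⟩
      exact ⟨fun i => m (i + 1), fun i => (hm (i + 1)).trans_lt (by omega), rfl⟩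
    · rintro ⟨m, hm, rfl⟩
      exact ⟨fun i => m (i - 1), fun i => Nat.le_sub_one_of_lt (hm (i - 1)), rfl⟩
  set G := Subgroup.closure X with hG
  have hbG : ∀ i < N, b i ∈ G := fun i hi => Subgroup.subset_closure <| by
    rw [hX]; exact .inl (.inl (.inl ⟨i + 1, by omega, by omega, rfl⟩))
  have hsqG : ∀ j, 1 ≤ j → j ≤ N + 1 → x j ^ 2 ∈ G := fun j h1 h2 => Subgroup.subset_closure <| by
    rw [hX]; exact .inl (.inl (.inr ⟨j, h1, h2, rfl⟩))
  have hyG : ∀ k, 1 ≤ k → k ≤ n - 1 → y k ∈ G := fun j h1 h2 => Subgroup.subset_closure <| by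
    rw [hX]; exact .inl (.inr ⟨j, h1, h2, rfl⟩)
  have hzG : ∀ k, 1 ≤ k → k ≤ n - 1 → c * y k * c⁻¹ ∈ G :=
    fun j h1 h2 => Subgroup.subset_closure <| by
      rw [hX]; exact .inr ⟨j, h1, h2, rfl⟩
  have hθb : ∀ i (hi : i < N), θ (b i) = Pi.single ⟨i, hi⟩ 1 := fun i hi =>
    hθx (i + 1) (by omega) (by omega)
  have hθ1 : θ 1 = 0 := by simpa using hhom 1 1 G.one_mem G.one_mem
  have hθinv : ∀ a ∈ G, θ a⁻¹ = -θ a := fun a ha => by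
    have := hhom a⁻¹ a (G.inv_mem ha) ha
    rw [inv_mul_cancel, hθ1] at this
    exact eq_neg_of_add_eq_zero_left this.symm
  have hθpow : ∀ a ∈ G, ∀ k : ℕ, θ (a ^ k) = k • θ a := fun a ha k => by
    induction k with
    | zero => simpa using hθ1
    | succ k ih => rw [pow_succ, hhom _ _ (G.pow_mem ha k) ha, ih, succ_nsmul]
  have hword : ∀ m : ℕ → ℕ, ∀ l ≤ N, powerWord b l m ∈ G ∧
      ∀ i : Fin N, θ (powerWord b l m) i = if (i : ℕ) < l then (m i : ZMod d) else 0 := by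
    intro m l hl
    induction l with
    | zero => simp [powerWord, hθ1]
    | succ l ih =>
      obtain ⟨h1, h2⟩ := ih (by omega)
      have hp := G.pow_mem (hbG l (by omega)) (m l)
      rw [powerWord_succ]
      refine ⟨G.mul_mem h1 hp, fun i => ?_⟩
      rw [hhom _ _ h1 hp, Pi.add_apply, h2, hθpow _ (hbG l (by omega)), hθb l (by omega)]
      rcases lt_trichotomy (i : ℕ) l with h | h | h
      · have : i ≠ ⟨l, by omega⟩ := fun e => by simp [e] at h
        simp [this, h, Nat.lt_succ_of_lt h]
      · subst h
        simp
      · have : i ≠ ⟨l, by omega⟩ := fun e => by simp [e] at h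
        simp [this, h.not_gt, show ¬ (i : ℕ) < l + 1 by omega]
  have hident : ∀ i j, (x (i + 1) * x (j + 1) * c) ^ 2 =
      b i * (b j)⁻¹ * (x (j + 1) ^ 2 * c ^ 2) * (b i)⁻¹ * x (i + 1) ^ 2 * b j := by
    intro i j
    simp only [hb, pow_two]
    group
  let ker : Subgroup H :=
    { carrier := {h | h ∈ G ∧ θ h = 0}
      one_mem' := ⟨G.one_mem, hθ1⟩
      mul_mem' := fun {u v} hu hv =>
        ⟨G.mul_mem hu.1 hv.1, by rw [hhom u v hu.1 hv.1, hu.2, hv.2, add_zero]⟩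
      inv_mem' := fun {u} hu => ⟨G.inv_mem hu.1, by rw [hθinv u hu.1, hu.2, neg_zero]⟩ }
  have hconj : ∀ w ∈ G, ∀ t ∈ ker, w * t * w⁻¹ ∈ ker := fun w hw t ht =>
    ⟨G.mul_mem (G.mul_mem hw ht.1) (G.inv_mem hw), by
      rw [hhom _ _ (G.mul_mem hw ht.1) (G.inv_mem hw), hhom _ _ hw ht.1, hθinv _ hw, ht.2]
      simp⟩
  have hsqker : ∀ j, 1 ≤ j → j ≤ N + 1 → x j ^ 2 ∈ ker := fun j h1 h2 =>
    ⟨hsqG j h1 h2, hθsq j h1 h2⟩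
  have hTker : ∀ t ∈ T, t ∈ ker := by
    intro t ht
    rw [hT] at ht
    rcases ht with (((⟨i, h1, h2, rfl⟩ | ⟨j, h1, h2, rfl⟩) | ⟨k, h1, h2, rfl⟩) |
      ⟨k, h1, h2, rfl⟩) | ⟨i, j, h1, h2, h3, rfl⟩
    · obtain ⟨i, rfl⟩ : ∃ k, i = k + 1 := ⟨i - 1, by omega⟩
      refine ⟨G.pow_mem (hbG i (by omega)) d, ?_⟩
      rw [hθpow _ (hbG i (by omega))]
      ext k
      simp
    · exact hsqker j h1 h2
    · exact ⟨hyG k h1 h2, hθy k h1 h2⟩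
    · exact ⟨hzG k h1 h2, hθz k h1 h2⟩
    · obtain ⟨i, rfl⟩ : ∃ k, i = k + 1 := ⟨i - 1, by omega⟩
      obtain ⟨j, rfl⟩ : ∃ k, j = k + 1 := ⟨j - 1, by omega⟩
      rw [hident]
      have hi := hbG i (by omega)
      have hj := hbG j (by omega)
      have hs := ker.mul_mem (hsqker (j + 1) (by omega) (by omega))
        (hsqker (N + 1) (by omega) le_rfl)
      have hq := hsqker (i + 1) (by omega) (by omega)
      have hs' := hconj _ (G.mul_mem hi (G.inv_mem hj)) _ hs
      have hq' := hconj _ (G.inv_mem hj) _ hq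
      have hcomm : b i * (b j)⁻¹ * (b i)⁻¹ * b j ∈ ker := by
        have h1 := G.mul_mem hi (G.inv_mem hj)
        have h2 := G.mul_mem h1 (G.inv_mem hi)
        refine ⟨G.mul_mem h2 hj, ?_⟩
        rw [hhom _ _ h2 hj, hhom _ _ h1 (G.inv_mem hi), hhom _ _ hi (G.inv_mem hj),
          hθinv _ hi, hθinv _ hj]
        abel
      convert ker.mul_mem (ker.mul_mem hs' hcomm) hq' using 1
      simp only [hc]
      group
  set K := Subgroup.closure {u | ∃ w ∈ W, ∃ t ∈ T, u = w * t * w⁻¹} with hK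
  have hKker : K ≤ ker := by
    rw [hK, Subgroup.closure_le]
    rintro _ ⟨w, hw, t, ht, rfl⟩
    obtain ⟨m, -, rfl⟩ := (hWmem w).1 hw
    exact hconj _ (hword m N le_rfl).1 t (hTker t ht)
  have hfix : ∀ m : ℕ → ℕ, (∀ i, m i < d) → ∀ t ∈ T,
      SameRightCoset K (powerWord b N m * t) (powerWord b N m) := fun m hm t ht =>
    Subgroup.subset_closure ⟨_, (hWmem _).2 ⟨m, hm, rfl⟩, t, ht, rfl⟩
  have hsqT : ∀ j, 1 ≤ j → j ≤ N + 1 → x j ^ 2 ∈ T := fun j h1 h2 => by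
    rw [hT]; exact .inl (.inl (.inl (.inr ⟨j, h1, h2, rfl⟩)))
  have hstep : ∀ m : ℕ → ℕ, (∀ i, m i < d) → ∀ i < N, SameRightCoset K (powerWord b N m * b i)
      (powerWord b N (Function.update m i ((m i + 1) % d))) := fun m hm i hi => by
    refine sameRightCoset_powerWord_mul (q := fun i => x (i + 1) ^ 2)
      (s := fun i => x (i + 1) ^ 2 * c ^ 2) (by omega) ?_ ?_ ?_ ?_ le_rfl hm hi
    · intro m hm i hi
      refine hfix m hm _ ?_
      rw [hT]; exact .inl (.inl (.inl (.inl ⟨i + 1, by omega, by omega, rfl⟩)))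
    · exact fun m hm i hi => hfix m hm _ (hsqT _ (by omega) (by omega))
    · intro m hm i hi
      rw [← mul_assoc]
      exact ((hfix m hm _ (hsqT (i + 1) (by omega) (by omega))).mul_right _).trans
        (hfix m hm _ (hsqT (N + 1) (by omega) le_rfl))
    · intro m hm i j hij hj
      rw [← hident]
      refine hfix m hm _ ?_
      rw [hT]; exact .inr ⟨i + 1, j + 1, by omega, by omega, by omega, rfl⟩
  have hupd : ∀ m : ℕ → ℕ, (∀ i, m i < d) → ∀ i k, ∀ j, Function.update m i (k % d) j < d := by
    intro m hm i k j
    by_cases hj : j = i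
    · subst hj
      simpa using Nat.mod_lt _ (by omega)
    · simpa [hj] using hm j
  have hXcases : ∀ s ∈ X, (∃ i < N, s = b i) ∨ s ∈ T := by
    intro s hs
    rw [hX] at hs
    rcases hs with ((⟨i, h1, h2, rfl⟩ | h) | h) | h
    · obtain ⟨i, rfl⟩ : ∃ k, i = k + 1 := ⟨i - 1, by omega⟩
      exact .inl ⟨i, by omega, rfl⟩
    · rw [hT]; exact .inr (.inl (.inl (.inl (.inr h))))
    · rw [hT]; exact .inr (.inl (.inl (.inr h)))
    · rw [hT]; exact .inr (.inl (.inr h))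
  have hcover : ∀ h ∈ G, ∃ m : ℕ → ℕ, (∀ i, m i < d) ∧ SameRightCoset K h (powerWord b N m) := by
    intro h hh
    induction hh using Subgroup.closure_induction_right with
    | one => exact ⟨fun _ => 0, fun _ => by dsimp only; omega, by simpa [powerWord] using .refl _⟩
    | mul_right u hu s hs ih =>
      obtain ⟨m, hm, hum⟩ := ih
      rcases hXcases s hs with ⟨i, hi, rfl⟩ | ht
      · exact ⟨_, hupd m hm i (m i + 1), (hum.mul_right _).trans (hstep m hm i hi)⟩
      · exact ⟨m, hm, (hum.mul_right _).trans (hfix m hm s ht)⟩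
    | mul_inv_cancel u hu s hs ih =>
      obtain ⟨m, hm, hum⟩ := ih
      rcases hXcases s hs with ⟨i, hi, rfl⟩ | ht
      · refine ⟨_, hupd m hm i (m i + (d - 1)), (hum.mul_right _).trans ?_⟩
        have h1 := hstep _ (hupd m hm i (m i + (d - 1))) i hi
        have h2 : ((m i + (d - 1)) % d + 1) % d = m i := by
          rw [Nat.mod_add_mod, show m i + (d - 1) + 1 = m i + d by omega, Nat.add_mod_right,
            Nat.mod_eq_of_lt (hm i)]
        rw [Function.update_self, h2, Function.update_idem, Function.update_eq_self] at h1
        simpa using (h1.mul_right (b i)⁻¹).symm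
      · exact ⟨m, hm, (hum.mul_right _).trans (hfix m hm s ht).mul_inv_right⟩
  intro h
  refine ⟨fun hh => hKker hh, fun ⟨hh, hθh⟩ => ?_⟩
  obtain ⟨m, hm, hhm⟩ := hcover h hh
  have hker : powerWord b N m ∈ ker := by
    have := ker.mul_mem (ker.inv_mem (hKker hhm)) (show h ∈ ker from ⟨hh, hθh⟩)
    simpa using this
  have hm0 : ∀ i < N, m i = 0 := by
    intro i hi
    have h1 := (hword m N le_rfl).2 ⟨i, hi⟩
    rw [hker.2, if_pos hi, Pi.zero_apply, eq_comm, ZMod.natCast_eq_zero_iff] at h1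
    exact Nat.eq_zero_of_dvd_of_lt h1 (hm i)
  have hw1 : powerWord b N m = 1 := by
    rw [powerWord_eq_of_forall_eq_zero b (Nat.zero_le N) fun i _ hi => hm0 i hi]
    rfl
  simpa [SameRightCoset, hw1] using hhm
end

section
/- Let G be a group generated by a set Y ∪ D, where Y is a finite totally ordered set. Suppose φ : G → (ℤ/2ℤ)^Y is a group homomorphism such that φ(y) = e_y (the standard basis vector indexed by y) for each y ∈ Y, and φ(x) = 0 for each x ∈ D. Call a product w = y_1 y_2 ⋯ y_m with y_1 < y_2 < ⋯ < y_m elements of Y an increasing word (the empty word, i.e., the identity, is allowed). Then the kernel of φ is generated by the following elements: (i) w x w^{−1} for x ∈ D and w an increasing word; (ii) w y^2 w^{−1} for y ∈ Y and w an increasing word; (iii) w [y, y′] w^{−1} for y < y′ in Y and w an increasing word all of whose letters are strictly smaller than y′, where [y, y′] = y y′ y^{−1} (y′)^{−1}. -/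
/-- If a subgroup `H` contains the conjugates by increasing words of the squares and of the
commutators of the family `Y`, then multiplying an increasing word by a member of the family
yields, modulo `H` on the left, an increasing word. -/
theorem exists_increasing_word_mul {G ι : Type*} [Group G] [LinearOrder ι] (Y : ι → G)
    (H : Subgroup G)
    (hsq : ∀ (i : ι) (l : List ι), l.Pairwise (· < ·) →
      (l.map Y).prod * Y i ^ 2 * ((l.map Y).prod)⁻¹ ∈ H)
    (hcomm : ∀ i j : ι, i < j → ∀ l : List ι, l.Pairwise (· < ·) → (∀ a ∈ l, a < j) →
      (l.map Y).prod * (Y i * Y j * (Y i)⁻¹ * (Y j)⁻¹) * ((l.map Y).prod)⁻¹ ∈ H)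
    (i : ι) (l : List ι) (hl : l.Pairwise (· < ·)) :
    ∃ l' : List ι, l'.Pairwise (· < ·) ∧ (∀ a ∈ l', a ∈ l ∨ a = i) ∧
      ∃ h ∈ H, (l.map Y).prod * Y i = h * (l'.map Y).prod := by
  induction l using List.reverseRecOn with
  | nil => exact ⟨[i], by simp, by simp, 1, H.one_mem, by simp⟩
  | append_singleton l j ih =>
    have hlj := List.pairwise_append.1 hl
    have hlt : ∀ a ∈ l, a < j := fun a ha => hlj.2.2 a ha j (by simp)
    rcases lt_trichotomy i j with hij | rfl | hji
    · obtain ⟨l', hl', hmem, h, hh, heq⟩ := ih hlj.1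
      have hlt' : ∀ a ∈ l', a < j := fun a ha =>
        (hmem a ha).elim (hlt a) fun hai => hai ▸ hij
      refine ⟨l' ++ [j], ?_, ?_, _, H.mul_mem (H.inv_mem (hcomm i j hij l hlj.1 hlt)) hh, ?_⟩
      · refine List.pairwise_append.2 ⟨hl', by simp, ?_⟩
        simpa using hlt'
      · intro a ha
        simp only [List.mem_append, List.mem_singleton] at ha ⊢
        rcases ha with ha | rfl
        · rcases hmem a ha with ha | rfl <;> simp_all
        · simp
      · have heq' : (l'.map Y).prod = h⁻¹ * ((l.map Y).prod * Y i) := by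
          rw [heq]; group
        simp only [List.map_append, List.prod_append, heq', List.map_cons, List.map_nil,
          List.prod_singleton]
        group
    · refine ⟨l, hlj.1, fun a ha => by simp [ha], _, hsq i l hlj.1, ?_⟩
      simp only [List.map_append, List.prod_append, List.map_cons, List.map_nil,
        List.prod_singleton, pow_two]
      group
    · refine ⟨l ++ [j] ++ [i], ?_, by simp [or_assoc], 1, H.one_mem, by simp [mul_assoc]⟩
      refine List.pairwise_append.2 ⟨hl, by simp, ?_⟩
      intro a ha b hb
      simp only [List.mem_append, List.mem_singleton] at ha hb
      subst hb
      rcases ha with ha | rfl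
      · exact (hlt a ha).trans hji
      · exact hji

/-- If a subgroup `H` contains the conjugates by increasing words of the elements of `D`, of the
squares and of the commutators of the family `Y`, then every element of the subgroup generated by
`Y` and `D` is, modulo `H` on the left, an increasing word. -/
theorem exists_increasing_word_of_mem_closure {G ι : Type*} [Group G] [LinearOrder ι] (Y : ι → G)
    (D : Set G) (H : Subgroup G)
    (hD : ∀ x ∈ D, ∀ l : List ι, l.Pairwise (· < ·) →
      (l.map Y).prod * x * ((l.map Y).prod)⁻¹ ∈ H)
    (hsq : ∀ (i : ι) (l : List ι), l.Pairwise (· < ·) →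
      (l.map Y).prod * Y i ^ 2 * ((l.map Y).prod)⁻¹ ∈ H)
    (hcomm : ∀ i j : ι, i < j → ∀ l : List ι, l.Pairwise (· < ·) → (∀ a ∈ l, a < j) →
      (l.map Y).prod * (Y i * Y j * (Y i)⁻¹ * (Y j)⁻¹) * ((l.map Y).prod)⁻¹ ∈ H)
    {g : G} (hg : g ∈ Subgroup.closure (Set.range Y ∪ D)) :
    ∃ l : List ι, l.Pairwise (· < ·) ∧ ∃ h ∈ H, g = h * (l.map Y).prod := by
  induction hg using Subgroup.closure_induction_right with
  | one => exact ⟨[], List.Pairwise.nil, 1, H.one_mem, by simp⟩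
  | mul_right g _ s hs ih =>
    obtain ⟨l, hl, h, hh, rfl⟩ := ih
    rcases hs with ⟨i, rfl⟩ | hs
    · obtain ⟨l', hl', -, k, hk, heq⟩ := exists_increasing_word_mul Y H hsq hcomm i l hl
      exact ⟨l', hl', h * k, H.mul_mem hh hk, by rw [mul_assoc, heq, mul_assoc]⟩
    · exact ⟨l, hl, _, H.mul_mem hh (hD s hs l hl), by group⟩
  | mul_inv_cancel g _ s hs ih =>
    obtain ⟨l, hl, h, hh, rfl⟩ := ih
    rcases hs with ⟨i, rfl⟩ | hs
    · obtain ⟨l', hl', -, k, hk, heq⟩ := exists_increasing_word_mul Y H hsq hcomm i l hl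
      refine ⟨l', hl', _, H.mul_mem (H.mul_mem hh (H.inv_mem (hsq i l hl))) hk, ?_⟩
      rw [mul_assoc _ k, ← heq]
      group
    · exact ⟨l, hl, _, H.mul_mem hh (H.inv_mem (hD s hs l hl)), by group⟩

/-- Abstract form of Lemma (M_4-gen): if G is generated by Y ∪ D with Y a finite
totally ordered set (given as an injective family over a finite linearly ordered
index type), and φ : G → (ℤ/2ℤ)^Y is a homomorphism with φ(y) = e_y for y ∈ Y and
φ = 0 on D, then ker φ is generated by the conjugates w x w⁻¹ (x ∈ D, w an
increasing word in Y), w y² w⁻¹ (y ∈ Y, w an increasing word), and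
w [y, y′] w⁻¹ (y < y′ in Y, w an increasing word with all letters < y′). -/
theorem stmt9 {G : Type*} [Group G] {ι : Type*} [Fintype ι] [LinearOrder ι]
    (Y : ι → G) (hY : Function.Injective Y) (D : Set G)
    (hgen : Subgroup.closure (Set.range Y ∪ D) = ⊤)
    (φ : G → (ι → ZMod 2))
    (hhom : ∀ a b : G, φ (a * b) = φ a + φ b)
    (hφY : ∀ i, φ (Y i) = Pi.single i 1)
    (hφD : ∀ x ∈ D, φ x = 0) :
    ∀ h : G, φ h = 0 ↔ h ∈ Subgroup.closure (
      {u | ∃ x ∈ D, ∃ l : List ι, l.Chain' (· < ·) ∧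
        u = (l.map Y).prod * x * ((l.map Y).prod)⁻¹} ∪
      {u | ∃ i : ι, ∃ l : List ι, l.Chain' (· < ·) ∧
        u = (l.map Y).prod * (Y i) ^ 2 * ((l.map Y).prod)⁻¹} ∪
      {u | ∃ i j : ι, i < j ∧ ∃ l : List ι, l.Chain' (· < ·) ∧ (∀ a ∈ l, a < j) ∧
        u = (l.map Y).prod * (Y i * Y j * (Y i)⁻¹ * (Y j)⁻¹) * ((l.map Y).prod)⁻¹}) := by
  have hone : φ 1 = 0 := by simpa using hhom 1 1
  have hinv : ∀ a, φ a⁻¹ = -φ a := fun a => by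
    rw [eq_neg_iff_add_eq_zero, ← hhom, inv_mul_cancel, hone]
  have hword : ∀ l : List ι, l.Pairwise (· < ·) → φ ((l.map Y).prod) = 0 → l = [] := by
    intro l hl h0
    cases l with
    | nil => rfl
    | cons i l =>
      have hnot : ∀ m : List ι, i ∉ m → φ ((m.map Y).prod) i = 0 := by
        intro m hm
        induction m with
        | nil => simp [hone]
        | cons j m ih =>
          simp only [List.mem_cons, not_or] at hm
          simp [hhom, hφY, ih hm.2, Pi.single_eq_of_ne hm.1]
      have hi : i ∉ l := fun h => lt_irrefl i ((List.pairwise_cons.1 hl).1 i h)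
      have := congrFun h0 i
      simp [hhom, hφY, hnot l hi] at this
  intro h
  set S : Set G := _ ∪ _ ∪ _
  have hker : ∀ k ∈ Subgroup.closure S, φ k = 0 := by
    intro k hk
    induction hk using Subgroup.closure_induction with
    | mem k hk =>
      rcases hk with (⟨x, hx, l, -, rfl⟩ | ⟨i, l, -, rfl⟩) | ⟨i, j, -, l, -, -, rfl⟩
      · simp [hhom, hinv, hφD x hx]
      · have hadd : φ (Y i) + φ (Y i) = 0 := funext fun _ => CharTwo.add_self_eq_zero _
        simp only [hhom, hinv, pow_two, hadd]
        abel
      · simp only [hhom, hinv]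
        abel
    | one => exact hone
    | mul a b _ _ ha hb => rw [hhom, ha, hb, add_zero]
    | inv a _ ha => rw [hinv, ha, neg_zero]
  refine ⟨fun h0 => ?_, hker h⟩
  obtain ⟨l, hl, k, hk, rfl⟩ := exists_increasing_word_of_mem_closure Y D (Subgroup.closure S)
    (fun x hx l hl => Subgroup.subset_closure
      (Or.inl (Or.inl ⟨x, hx, l, List.isChain_iff_pairwise.2 hl, rfl⟩)))
    (fun i l hl => Subgroup.subset_closure
      (Or.inl (Or.inr ⟨i, l, List.isChain_iff_pairwise.2 hl, rfl⟩)))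
    (fun i j hij l hl hlt => Subgroup.subset_closure
      (Or.inr ⟨i, j, hij, l, List.isChain_iff_pairwise.2 hl, hlt, rfl⟩))
    (hgen ▸ Subgroup.mem_top h)
  rw [hhom, hker k hk, zero_add] at h0
  simpa [hword l hl h0] using hk
end
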